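/- Let n and b be integers with n ≥ 1 and b ≥ 1. Then ∑_{k=0}^{n} (-1)^k · C(n,k) · H_{k+b}/(k+b) = (H_{n+b} − H_n) / (b · C(b+n, b)), where all quotients are taken in ℚ (equivalently ℝ). -/

import Mathlib

theorem alternating_sum_choose_succ {R : Type*} [CommRing R] (f : ℕ → R) (n : ℕ) :
    ∑ k ∈ Finset.range (n + 2), (-1 : R) ^ k * ((n + 1).choose k : R) * f k
      = ∑ k ∈ Finset.range (n + 1), (-1 : R) ^ k * (n.choose k : R) * f k
        - ∑ k ∈ Finset.range (n + 1), (-1 : R) ^ k * (n.choose k : R) * f (k + 1) := by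
  have h : ∑ k ∈ Finset.range (n + 1), (-1 : R) ^ k * (n.choose k : R) * f k
      = ∑ k ∈ Finset.range (n + 2), (-1 : R) ^ k * (n.choose k : R) * f k := by
    simp [Finset.sum_range_succ _ (n + 1)]
  rw [h, Finset.sum_range_succ', Finset.sum_range_succ' _ (n + 1), add_sub_right_comm,
    ← Finset.sum_sub_distrib]
  congr 1
  · refine Finset.sum_congr rfl fun k _ => ?_
    rw [Nat.choose_succ_succ]
    push_cast
    ring
  · simp

theorem alternating_sum_choose_harmonic_div (n b : ℕ) (hb : 1 ≤ b) :
    ∑ k ∈ Finset.range (n + 1),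
        (-1 : ℚ) ^ k * (n.choose k : ℚ) * (harmonic (k + b) / ((k : ℚ) + b))
      = (harmonic (n + b) - harmonic n) / ((b : ℚ) * ((b + n).choose b : ℚ)) := by
  induction n generalizing b with
  | zero => simp
  | succ n ih =>
    have shift : ∀ k : ℕ, harmonic (k + 1 + b) / (((k + 1 : ℕ) : ℚ) + b)
        = harmonic (k + (b + 1)) / ((k : ℚ) + (b + 1 : ℕ)) := by
      intro k
      rw [show k + 1 + b = k + (b + 1) by ring]
      push_cast
      ring
    rw [alternating_sum_choose_succ (fun k => harmonic (k + b) / ((k : ℚ) + b))]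
    simp only [shift]
    rw [ih b hb, ih (b + 1) (by omega)]
    have hc : ((b + n).choose b : ℚ) ≠ 0 := by
      exact_mod_cast (Nat.choose_pos (Nat.le_add_right b n)).ne'
    have hb0 : (b : ℚ) ≠ 0 := by exact_mod_cast (by omega : b ≠ 0)
    have hn0 : (n : ℚ) + 1 ≠ 0 := by positivity
    have hm0 : (n : ℚ) + b + 1 ≠ 0 := by positivity
    have hchoose : ((b + 1 + n).choose (b + 1) : ℚ)
        = (n + b + 1) * ((b + n).choose b : ℚ) / (b + 1) := by
      rw [eq_div_iff (by positivity), show b + 1 + n = b + n + 1 by ring]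
      have := Nat.add_one_mul_choose_eq (b + n) b
      have h : ((b + n + 1 : ℚ)) * ((b + n).choose b : ℚ)
          = ((b + n + 1).choose (b + 1) : ℚ) * (b + 1) := by exact_mod_cast this
      linarith
    have hchoose' : ((b + (n + 1)).choose b : ℚ)
        = (n + b + 1) * ((b + n).choose b : ℚ) / (n + 1) := by
      rw [eq_div_iff hn0]
      have := Nat.choose_mul_succ_eq (b + n) b
      rw [show b + n + 1 - b = n + 1 by omega] at this
      have h : ((b + n).choose b : ℚ) * (b + n + 1)
          = ((b + (n + 1)).choose b : ℚ) * (n + 1) := by exact_mod_cast this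
      linarith
    rw [hchoose, hchoose', show n + 1 + b = n + b + 1 by ring, ← add_assoc n b 1,
      harmonic_succ, harmonic_succ]
    push_cast
    field_simp
    ring

theorem binomial_transform_harmonic (n b : ℕ) (hn : 1 ≤ n) (hb : 1 ≤ b) :
    ∑ k ∈ Finset.range (n + 1),
        (-1 : ℚ) ^ k * (n.choose k : ℚ) * harmonic (k + b) / ((k : ℚ) + b)
      = (harmonic (n + b) - harmonic n) / ((b : ℚ) * ((b + n).choose b : ℚ)) := by
  simpa only [mul_div_assoc] using alternating_sum_choose_harmonic_div n b hb
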